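/- (Discrete energy dissipation for the Cahn–Hilliard–Navier–Stokes scheme.) Let d ≥ 1, γ > 0, τ > 0, let f : ℝ → ℝ be continuously differentiable, let m, η : ℝ → ℝ be continuous with m ≥ 0 and η ≥ 0, let φⁿ, φⁿ⁺¹, μⁿ⁺¹, pⁿ⁺¹ : ℝ^d → ℝ and vⁿ, vⁿ⁺¹ : ℝ^d → ℝ^d be continuously differentiable and ℤ^d-periodic. Define F(a,b) := ∫₀¹ f′(b + s(a − b)) ds, d_τφ := (φⁿ⁺¹ − φⁿ)/τ, d_τv := (vⁿ⁺¹ − vⁿ)/τ, D w := ½(∇w + (∇w)ᵀ), and the skew-symmetric form c_skw(u, w, z) := ½⟨(u·∇)w, z⟩ − ½⟨(u·∇)z, w⟩. Suppose: (i) ⟨ d_τφ, μⁿ⁺¹ ⟩ − ⟨ φⁿ⁺¹ vⁿ⁺¹, ∇μⁿ⁺¹ ⟩ + ⟨ m(φⁿ⁺¹) ∇μⁿ⁺¹, ∇μⁿ⁺¹ ⟩ = 0; (ii) ⟨ μⁿ⁺¹, d_τφ ⟩ − γ ⟨ ∇φⁿ⁺¹, ∇ d_τφ ⟩ − ⟨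 F(φⁿ⁺¹, φⁿ), d_τφ ⟩ = 0; (iii) ⟨ d_τv, vⁿ⁺¹ ⟩ + c_skw(vⁿ⁺¹, vⁿ⁺¹, vⁿ⁺¹) + ⟨ η(φⁿ⁺¹) D vⁿ⁺¹, D vⁿ⁺¹ ⟩ − ⟨ pⁿ⁺¹, div(vⁿ⁺¹) ⟩ + ⟨ φⁿ⁺¹ ∇μⁿ⁺¹, vⁿ⁺¹ ⟩ = 0; (iv) ⟨ div(vⁿ⁺¹), pⁿ⁺¹ ⟩ = 0; where ⟨·,·⟩ is the L² inner product over the unit cube Ω = [0,1]^d. Then E₁(φⁿ⁺¹, vⁿ⁺¹) + τ ⟨ m(φⁿ⁺¹) ∇μⁿ⁺¹, ∇μⁿ⁺¹ ⟩ + τ ⟨ η(φⁿ⁺¹) D vⁿ⁺¹, D vⁿ⁺¹ ⟩ ≤ E₁(φⁿ, vⁿ), where E₁(φ, v) = ∫_Ω ( (γ/2)|∇φ|² + f(φ) + ½|v|² ) dx. -/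

import Mathlib

open MeasureTheory

/-- The `i`-th partial derivative of a function `g : ℝ^d → ℝ`. -/
noncomputable def pderiv {d : ℕ} (g : (Fin d → ℝ) → ℝ) (i : Fin d) (x : Fin d → ℝ) : ℝ :=
  fderiv ℝ g x (Pi.single i 1)

/-- `ℤ^d`-periodicity of a function on `ℝ^d`. -/
def ZdPeriodic {d : ℕ} {E : Type*} (g : (Fin d → ℝ) → E) : Prop :=
  ∀ (x : Fin d → ℝ) (k : Fin d → ℤ), g (x + fun i => (k i : ℝ)) = g x

/-- The time-averaged potential derivative `F(a,b) = ∫₀¹ f′(b + s(a−b)) ds`. -/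
noncomputable def timeAvgF (f : ℝ → ℝ) (a b : ℝ) : ℝ :=
  ∫ s in (0:ℝ)..1, deriv f (b + s * (a - b))

/-- The symmetric gradient `(Dw)_{ij} = ½(∂_j w_i + ∂_i w_j)` of a vector field. -/
noncomputable def symGrad {d : ℕ} (w : (Fin d → ℝ) → Fin d → ℝ)
    (i j : Fin d) (x : Fin d → ℝ) : ℝ :=
  1 / 2 * (pderiv (fun y => w y i) j x + pderiv (fun y => w y j) i x)

/-- The skew-symmetric trilinear form
`c_skw(u,w,z) = ½⟨(u·∇)w, z⟩ − ½⟨(u·∇)z, w⟩` over the unit cube `Ω = [0,1]^d`. -/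
noncomputable def cskw {d : ℕ} (u w z : (Fin d → ℝ) → Fin d → ℝ) : ℝ :=
  1 / 2 * (∫ x in Set.Icc (0 : Fin d → ℝ) 1,
      ∑ i, (∑ j, u x j * pderiv (fun y => w y i) j x) * z x i) -
    1 / 2 * (∫ x in Set.Icc (0 : Fin d → ℝ) 1,
      ∑ i, (∑ j, u x j * pderiv (fun y => z y i) j x) * w x i)

theorem continuous_pderiv {d : ℕ} {g : (Fin d → ℝ) → ℝ} (hg : ContDiff ℝ 1 g) (i : Fin d) :
    Continuous (pderiv g i) :=
  (hg.continuous_fderiv one_ne_zero).clm_apply continuous_const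

theorem pderiv_sub_div {d : ℕ} {g h : (Fin d → ℝ) → ℝ} {x : Fin d → ℝ}
    (hg : DifferentiableAt ℝ g x) (hh : DifferentiableAt ℝ h x) (c : ℝ) (i : Fin d) :
    pderiv (fun y => (g y - h y) / c) i x = (pderiv g i x - pderiv h i x) / c := by
  have key := (hg.hasFDerivAt.sub hh.hasFDerivAt).mul_const c⁻¹
  have : HasFDerivAt (fun y => (g y - h y) / c) (c⁻¹ • (fderiv ℝ g x - fderiv ℝ h x)) x := by
    simpa [div_eq_mul_inv] using key
  simp only [pderiv, this.fderiv, smul_apply, sub_apply, smul_eq_mul]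
  ring

theorem timeAvgF_mul_sub {f : ℝ → ℝ} (hf : ContDiff ℝ 1 f) (a b : ℝ) :
    timeAvgF f a b * (a - b) = f a - f b := by
  have hderiv : ∀ s ∈ Set.uIcc (0 : ℝ) 1, HasDerivAt (fun s => f (b + s * (a - b)))
      (deriv f (b + s * (a - b)) * (a - b)) s := fun s _ => by
    have hline : HasDerivAt (fun s : ℝ => b + s * (a - b)) (a - b) s := by
      simpa using ((hasDerivAt_id s).mul_const (a - b)).const_add b
    exact (hf.differentiable one_ne_zero _).hasDerivAt.comp s hline
  have hcont : Continuous fun s : ℝ => deriv f (b + s * (a - b)) * (a - b) :=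
    ((hf.continuous_deriv le_rfl).comp (by fun_prop)).mul continuous_const
  have key := intervalIntegral.integral_eq_sub_of_hasDerivAt hderiv
    (hcont.intervalIntegrable 0 1)
  rw [intervalIntegral.integral_mul_const] at key
  simpa [timeAvgF] using key

theorem half_sum_sq_le {ι : Type*} (s : Finset ι) (a b : ι → ℝ) {τ : ℝ} (hτ : τ ≠ 0) :
    1 / 2 * ∑ i ∈ s, a i ^ 2 ≤
      1 / 2 * ∑ i ∈ s, b i ^ 2 + τ * ∑ i ∈ s, a i * ((a i - b i) / τ) := by
  simp only [Finset.mul_sum, ← Finset.sum_add_distrib]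
  refine Finset.sum_le_sum fun i _ => ?_
  have : τ * (a i * ((a i - b i) / τ)) = a i * (a i - b i) := by field_simp
  rw [this]
  nlinarith [sq_nonneg (a i - b i)]

/-- Discrete energy dissipation for the Cahn–Hilliard–Navier–Stokes scheme:
`E₁(φⁿ⁺¹, vⁿ⁺¹) + τ⟨m(φⁿ⁺¹)∇μⁿ⁺¹, ∇μⁿ⁺¹⟩ + τ⟨η(φⁿ⁺¹)Dvⁿ⁺¹, Dvⁿ⁺¹⟩ ≤ E₁(φⁿ, vⁿ)`
over the unit cube `Ω = [0,1]^d`. -/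
theorem CHNS_discrete_energy_dissipation (d : ℕ) (hd : 1 ≤ d)
    (γ τ : ℝ) (hγ : 0 < γ) (hτ : 0 < τ)
    (f : ℝ → ℝ) (hf : ContDiff ℝ 1 f)
    (m η : ℝ → ℝ) (hm : Continuous m) (hη : Continuous η)
    (hm0 : ∀ s : ℝ, 0 ≤ m s) (hη0 : ∀ s : ℝ, 0 ≤ η s)
    (φn φn1 μn1 pn1 : (Fin d → ℝ) → ℝ) (vn vn1 : (Fin d → ℝ) → Fin d → ℝ)
    (hφn : ContDiff ℝ 1 φn) (hφn1 : ContDiff ℝ 1 φn1) (hμn1 : ContDiff ℝ 1 μn1)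
    (hpn1 : ContDiff ℝ 1 pn1) (hvn : ContDiff ℝ 1 vn) (hvn1 : ContDiff ℝ 1 vn1)
    (hφnper : ZdPeriodic φn) (hφn1per : ZdPeriodic φn1) (hμn1per : ZdPeriodic μn1)
    (hpn1per : ZdPeriodic pn1) (hvnper : ZdPeriodic vn) (hvn1per : ZdPeriodic vn1)
    (hi : (∫ x in Set.Icc (0 : Fin d → ℝ) 1, (φn1 x - φn x) / τ * μn1 x) -
        (∫ x in Set.Icc (0 : Fin d → ℝ) 1,
          ∑ i, φn1 x * vn1 x i * pderiv μn1 i x) +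
        (∫ x in Set.Icc (0 : Fin d → ℝ) 1,
          m (φn1 x) * ∑ i, (pderiv μn1 i x) ^ 2) = 0)
    (hii : (∫ x in Set.Icc (0 : Fin d → ℝ) 1, μn1 x * ((φn1 x - φn x) / τ)) -
        γ * (∫ x in Set.Icc (0 : Fin d → ℝ) 1,
          ∑ i, pderiv φn1 i x * pderiv (fun y => (φn1 y - φn y) / τ) i x) -
        (∫ x in Set.Icc (0 : Fin d → ℝ) 1,
          timeAvgF f (φn1 x) (φn x) * ((φn1 x - φn x) / τ)) = 0)
    (hiii : (∫ x in Set.Icc (0 : Fin d → ℝ) 1,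
          ∑ i, (vn1 x i - vn x i) / τ * vn1 x i) +
        cskw vn1 vn1 vn1 +
        (∫ x in Set.Icc (0 : Fin d → ℝ) 1,
          η (φn1 x) * ∑ i, ∑ j, (symGrad vn1 i j x) ^ 2) -
        (∫ x in Set.Icc (0 : Fin d → ℝ) 1,
          pn1 x * ∑ i, pderiv (fun y => vn1 y i) i x) +
        (∫ x in Set.Icc (0 : Fin d → ℝ) 1,
          ∑ i, φn1 x * pderiv μn1 i x * vn1 x i) = 0)
    (hiv : (∫ x in Set.Icc (0 : Fin d → ℝ) 1,
        (∑ i, pderiv (fun y => vn1 y i) i x) * pn1 x) = 0) :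
    (∫ x in Set.Icc (0 : Fin d → ℝ) 1,
        (γ / 2 * ∑ i, (pderiv φn1 i x) ^ 2 + f (φn1 x) +
          1 / 2 * ∑ i, (vn1 x i) ^ 2)) +
      τ * (∫ x in Set.Icc (0 : Fin d → ℝ) 1,
        m (φn1 x) * ∑ i, (pderiv μn1 i x) ^ 2) +
      τ * (∫ x in Set.Icc (0 : Fin d → ℝ) 1,
        η (φn1 x) * ∑ i, ∑ j, (symGrad vn1 i j x) ^ 2) ≤
      ∫ x in Set.Icc (0 : Fin d → ℝ) 1,
        (γ / 2 * ∑ i, (pderiv φn i x) ^ 2 + f (φn x) +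
          1 / 2 * ∑ i, (vn x i) ^ 2) := by
  have hskew : cskw vn1 vn1 vn1 = 0 := sub_self _
  have hmul : (∫ x in Set.Icc (0 : Fin d → ℝ) 1, μn1 x * ((φn1 x - φn x) / τ)) =
      ∫ x in Set.Icc (0 : Fin d → ℝ) 1, (φn1 x - φn x) / τ * μn1 x := by
    simp only [mul_comm]
  have hadv : (∫ x in Set.Icc (0 : Fin d → ℝ) 1, ∑ i, φn1 x * pderiv μn1 i x * vn1 x i) =
      ∫ x in Set.Icc (0 : Fin d → ℝ) 1, ∑ i, φn1 x * vn1 x i * pderiv μn1 i x := by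
    simp only [mul_right_comm]
  have hpress : (∫ x in Set.Icc (0 : Fin d → ℝ) 1,
      pn1 x * ∑ i, pderiv (fun y => vn1 y i) i x) = 0 := by
    rw [← hiv]
    simp only [mul_comm]
  have hgrad : ∀ x i, pderiv (fun y => (φn1 y - φn y) / τ) i x =
      (pderiv φn1 i x - pderiv φn i x) / τ := fun x i =>
    pderiv_sub_div (hφn1.differentiable one_ne_zero x) (hφn.differentiable one_ne_zero x) τ i
  have hpot : ∀ x, timeAvgF f (φn1 x) (φn x) * ((φn1 x - φn x) / τ) =
      (f (φn1 x) - f (φn x)) / τ := fun x => by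
    rw [← mul_div_assoc, timeAvgF_mul_sub hf]
  simp only [hgrad, hpot, hskew, hmul, hpress, hadv] at hii hiii
  have cf := hf.continuous
  have cφ := hφn.continuous
  have cφ1 := hφn1.continuous
  have cv := hvn.continuous
  have cv1 := hvn1.continuous
  have cgφ := continuous_pderiv hφn
  have cgφ1 := continuous_pderiv hφn1
  have intE : IntegrableOn (fun x => γ / 2 * ∑ i, (pderiv φn i x) ^ 2 + f (φn x) +
      1 / 2 * ∑ i, (vn x i) ^ 2) (Set.Icc (0 : Fin d → ℝ) 1) :=
    Continuous.integrableOn_Icc (by fun_prop)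
  have intE1 : IntegrableOn (fun x => γ / 2 * ∑ i, (pderiv φn1 i x) ^ 2 + f (φn1 x) +
      1 / 2 * ∑ i, (vn1 x i) ^ 2) (Set.Icc (0 : Fin d → ℝ) 1) :=
    Continuous.integrableOn_Icc (by fun_prop)
  have intA : IntegrableOn (fun x => ∑ i, pderiv φn1 i x *
      ((pderiv φn1 i x - pderiv φn i x) / τ)) (Set.Icc (0 : Fin d → ℝ) 1) :=
    Continuous.integrableOn_Icc (by fun_prop)
  have intB : IntegrableOn (fun x => (f (φn1 x) - f (φn x)) / τ) (Set.Icc (0 : Fin d → ℝ) 1) :=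
    Continuous.integrableOn_Icc (by fun_prop)
  have intC : IntegrableOn (fun x => ∑ i, (vn1 x i - vn x i) / τ * vn1 x i)
      (Set.Icc (0 : Fin d → ℝ) 1) :=
    Continuous.integrableOn_Icc (by fun_prop)
  have hpointwise : ∀ x, γ / 2 * ∑ i, (pderiv φn1 i x) ^ 2 + f (φn1 x) +
        1 / 2 * ∑ i, (vn1 x i) ^ 2 ≤
      (γ / 2 * ∑ i, (pderiv φn i x) ^ 2 + f (φn x) + 1 / 2 * ∑ i, (vn x i) ^ 2) +
        (τ * γ * ∑ i, pderiv φn1 i x * ((pderiv φn1 i x - pderiv φn i x) / τ) +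
          (τ * ((f (φn1 x) - f (φn x)) / τ) +
            τ * ∑ i, (vn1 x i - vn x i) / τ * vn1 x i)) := fun x => by
    have hφle := mul_le_mul_of_nonneg_left (half_sum_sq_le Finset.univ
      (fun i => pderiv φn1 i x) (fun i => pderiv φn i x) hτ.ne') hγ.le
    have hvle := half_sum_sq_le Finset.univ (vn1 x) (vn x) hτ.ne'
    simp only [mul_comm (vn1 x _)] at hvle
    rw [mul_div_cancel₀ _ hτ.ne']
    linarith
  have hmono := integral_mono (μ := volume.restrict (Set.Icc (0 : Fin d → ℝ) 1)) intE1
    (intE.add ((intA.const_mul (τ * γ)).add ((intB.const_mul τ).add (intC.const_mul τ))))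
    hpointwise
  rw [integral_add' intE ((intA.const_mul (τ * γ)).add
      ((intB.const_mul τ).add (intC.const_mul τ))),
    integral_add' (intA.const_mul (τ * γ)) ((intB.const_mul τ).add (intC.const_mul τ)),
    integral_add' (intB.const_mul τ) (intC.const_mul τ),
    integral_const_mul, integral_const_mul, integral_const_mul] at hmono
  linear_combination hmono + τ * hi - τ * hii + τ * hiii
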